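/- arXiv:2103.04488 — 3 statements merged into one kernel-verified Lean document; each statement's English description precedes it below -/
import Mathlib

section
/- For every integer m ≥ 2 it holds that √π ((m-1)/e)^{m-1} ≤ Γ(m - 1/2) ≤ √(2π) ((m-1)/e)^{m-1}. -/
open Real MeasureTheory

lemma gamma_half_fact (n : ℕ) :
    Real.Gamma ((n : ℝ) + 1/2) * (4 ^ n * (n.factorial : ℝ)) = ((2 * n).factorial : ℝ) * √π := by
  induction n with
  | zero => simp [-one_div, Real.Gamma_one_half_eq]
  | succ k ih =>
    have h : ((k + 1 : ℕ) : ℝ) + 1/2 = ((k : ℝ) + 1/2) + 1 := by push_cast; ring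
    rw [h, Real.Gamma_add_one (by positivity), show 2 * (k + 1) = 2 * k + 1 + 1 by ring,
      Nat.factorial_succ, Nat.factorial_succ, Nat.factorial_succ]
    push_cast
    linear_combination (2 * (k : ℝ) + 1) * (2 * k + 2) * ih

lemma gamma_half_stirling (n : ℕ) (hn : 1 ≤ n) :
    Real.Gamma ((n : ℝ) + 1/2) * Stirling.stirlingSeq n
      = √(2 * π) * ((n : ℝ) / Real.exp 1) ^ n * Stirling.stirlingSeq (2 * n) := by
  have h := gamma_half_fact n
  have hn' : (0 : ℝ) < n := by exact_mod_cast hn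
  have e1 : √(2 * ((2 * n : ℕ) : ℝ)) = √2 * √(2 * n) := by
    rw [← Real.sqrt_mul (by norm_num)]; push_cast; rfl
  have e2 : (((2 * n : ℕ) : ℝ) / Real.exp 1) ^ (2 * n)
      = 4 ^ n * (((n : ℝ) / Real.exp 1) ^ n * ((n : ℝ) / Real.exp 1) ^ n) := by
    rw [pow_mul, ← mul_pow, ← mul_pow]; push_cast; congr 1; ring
  have e3 : √(2 * π) = √2 * √π := Real.sqrt_mul (by norm_num) _
  unfold Stirling.stirlingSeq
  rw [e1, e2, e3]
  have p1 : 0 < √(2 * (n : ℝ)) := by positivity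
  have p2 : 0 < ((n : ℝ) / Real.exp 1) ^ n := by positivity
  have p3 : 0 < √(2 : ℝ) := by positivity
  generalize √(2 * (n : ℝ)) = a at *
  generalize ((n : ℝ) / Real.exp 1) ^ n = b at *
  generalize √(2 : ℝ) = c at *
  generalize Real.Gamma ((n : ℝ) + 1/2) = g at *
  field_simp
  linear_combination h

theorem gamma_half_shift_bounds (m : ℕ) (hm : 2 ≤ m) :
    Real.sqrt π * (((m : ℝ) - 1) / Real.exp 1) ^ (m - 1)
        ≤ (∫ t in Set.Ioi (0:ℝ), t ^ ((m : ℝ) - 1/2 - 1) * Real.exp (-t)) ∧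
    (∫ t in Set.Ioi (0:ℝ), t ^ ((m : ℝ) - 1/2 - 1) * Real.exp (-t))
        ≤ Real.sqrt (2 * π) * (((m : ℝ) - 1) / Real.exp 1) ^ (m - 1) := by
  obtain ⟨k, rfl⟩ : ∃ k, m = k + 1 + 1 := ⟨m - 2, by omega⟩
  have hI : (∫ t in Set.Ioi (0:ℝ), t ^ (((k + 1 + 1 : ℕ) : ℝ) - 1/2 - 1) * Real.exp (-t))
      = Real.Gamma (((k + 1 : ℕ) : ℝ) + 1/2) := by
    rw [Real.Gamma_eq_integral (by positivity)]
    congr 1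
    ext t
    rw [mul_comm]
    congr 2
    push_cast
    ring
  have hc : ((k + 1 + 1 : ℕ) : ℝ) - 1 = ((k + 1 : ℕ) : ℝ) := by push_cast; ring
  rw [hI, hc, Nat.add_sub_cancel]
  have h := gamma_half_stirling (k + 1) (by omega)
  have s1 : Stirling.stirlingSeq (2 * (k + 1)) ≤ Stirling.stirlingSeq (k + 1) :=
    Stirling.stirlingSeq'_antitone (show k ≤ 2 * k + 1 by omega)
  have s2 : Stirling.stirlingSeq (k + 1) ≤ Real.exp 1 / √2 := by
    rw [← Stirling.stirlingSeq_one]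
    exact Stirling.stirlingSeq'_antitone (Nat.zero_le k)
  have s3 : √π ≤ Stirling.stirlingSeq (2 * (k + 1)) :=
    Stirling.sqrt_pi_le_stirlingSeq (by omega)
  have s0 : 0 < Stirling.stirlingSeq (k + 1) := Stirling.stirlingSeq'_pos k
  have p2 : 0 < (((k + 1 : ℕ) : ℝ) / Real.exp 1) ^ (k + 1) := by positivity
  have s4 : Stirling.stirlingSeq (k + 1) ≤ √2 * √π := by
    refine s2.trans ?_
    rw [div_le_iff₀ (by positivity)]
    have : (1.7 : ℝ) ≤ √π := Real.le_sqrt_of_sq_le (by nlinarith [Real.pi_gt_three])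
    have h2 : √(2:ℝ) * √2 = 2 := Real.mul_self_sqrt (by norm_num)
    nlinarith [Real.exp_one_lt_d9]
  constructor
  · refine le_of_mul_le_mul_right ?_ s0
    rw [h, Real.sqrt_mul (by norm_num) π]
    calc _ ≤ √π * (((k + 1 : ℕ) : ℝ) / Real.exp 1) ^ (k + 1) * (√2 * √π) := by gcongr
      _ = √2 * √π * (((k + 1 : ℕ) : ℝ) / Real.exp 1) ^ (k + 1) * √π := by ring
      _ ≤ _ := by gcongr
  · refine le_of_mul_le_mul_right ?_ s0
    rw [h]
    gcongr
end

section
/- For every integer d ≥ 3, all β, σ in (0, ∞), and every nonnegative integer k it holds that ∫_{{x ∈ ℝ^d : ‖x‖₂ ≥ √(d(1+β))/√(2σ)}} (σ/π)^{d/2} ‖x‖₂^k e^{-σ‖x‖₂²} dx ≤ d^{1+k} ((1+β)/(2σ))^{k/2} ((1+β)/e^β)^{d/2} + (Γ((d+k)/2)/Γ(d/2)) ((d+k)/σ^{k/2}) e^{-d²(1+β)/(2(d+k))}. -/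
open Real MeasureTheory

lemma core (p q a G Gs Gp : ℝ) (hp : 3/2 ≤ p) (hq : 0 ≤ q) (ha : p < a)
    (hGp : 0 < Gp) (hGs : 0 < Gs) (h1 : Gs ≤ Gp * exp (q * log (p+q))) (h2 : G ≤ Gs)
    (h3 : p + q ≤ a → G ≤ exp ((p+q) * log a - a)) (h4 : exp (p * log p - p) ≤ Gp * p) :
    G ≤ Gp * exp (p - p * log p + (1+q) * log (2*p) + (p+q) * log a - a)
      + Gs * (2*(p+q)) * exp (-(a*p/(p+q))) := by
  have hp0 : 0 < p := by linarith
  have ha0 : 0 < a := by linarith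
  have hs0 : 0 < p + q := by linarith
  have hl2p : log (2*p) = log 2 + log p := Real.log_mul (by norm_num) hp0.ne'
  have hl2p0 : 0 ≤ log (2*p) := Real.log_nonneg (by linarith)
  have n1 : 0 ≤ Gp * exp (p - p * log p + (1+q) * log (2*p) + (p+q) * log a - a) := by positivity
  have n2 : 0 ≤ Gs * (2*(p+q)) * exp (-(a*p/(p+q))) := by positivity
  by_cases c1 : p + q ≤ a
  · refine (h3 c1).trans (le_add_of_le_of_nonneg ?_ n2)
    have : exp ((p+q) * log a - a) = exp (p * log p - p) * exp (p - p * log p + (p+q) * log a - a) := by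
      rw [← exp_add]; ring_nf
    rw [this]
    have e2 : exp (p - p * log p + (1+q) * log (2*p) + (p+q) * log a - a)
       = exp (log (2*p)) * (exp (q * log (2*p)) * exp (p - p * log p + (p+q) * log a - a)) := by
      rw [← exp_add, ← exp_add]; ring_nf
    rw [e2, exp_log (by linarith), ← mul_assoc, ← mul_assoc]
    gcongr
    have e3 : 1 ≤ exp (q * log (2*p)) := Real.one_le_exp (by positivity)
    nlinarith [mul_pos hGp hp0]
  push Not at c1
  by_cases c2 : 1 ≤ (2*(p+q)) * exp (-(a*p/(p+q)))
  · refine h2.trans (le_add_of_nonneg_of_le n1 ?_)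
    rw [mul_assoc]; nlinarith
  push Not at c2
  refine h2.trans (h1.trans (le_add_of_le_of_nonneg ?_ n2))
  gcongr
  by_cases c3 : p + q ≤ 2*p^2
  · have l1 : log (p+q) ≤ log 2 + 2 * log p := by
      rw [show log 2 + 2 * log p = log (2*p^2) by
        rw [Real.log_mul (by norm_num) (by positivity), Real.log_pow]; norm_num]
      exact Real.log_le_log hs0 c3
    have l2 : (a - p) / (p+q) ≤ log a - log p := by
      have := Real.one_sub_inv_le_log_of_pos (show 0 < a/p by positivity)
      rw [Real.log_div ha0.ne' hp0.ne'] at this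
      refine le_trans ?_ this
      rw [inv_div, ← sub_nonneg.symm.trans sub_nonneg]
      calc (a-p)/(p+q) ≤ (a-p)/a := by gcongr
        _ = 1 - p/a := by field_simp
    rw [div_le_iff₀ hs0] at l2
    have := mul_le_mul_of_nonneg_left l1 hq
    nlinarith
  · push Not at c3
    have l3 : log (2*(p+q)) < a*p/(p+q) := by
      have := Real.log_lt_log (by positivity) c2
      rw [Real.log_mul (by positivity) (by positivity), Real.log_exp, Real.log_one] at this
      linarith
    set L := log (2*(p+q)) with hL
    have hL2 : 2 ≤ L := by
      rw [hL, Real.le_log_iff_exp_le (by positivity)]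
      have := Real.exp_one_lt_d9
      rw [show (2:ℝ) = 1 + 1 by norm_num, exp_add]
      nlinarith [exp_pos 1]
    rw [lt_div_iff₀ hs0] at l3
    have l4 : log L + log (p+q) ≤ log a + log p := by
      rw [← Real.log_mul (by positivity) (by positivity), ← Real.log_mul (by positivity) (by positivity)]
      exact Real.log_le_log (by positivity) l3.le
    have l5 : 1 ≤ log 2 + log L := by
      rw [← Real.log_mul (by positivity) (by positivity), Real.le_log_iff_exp_le (by positivity)]
      have := Real.exp_one_lt_d9
      linarith
    have l6 : log 2 + 2 * log p ≤ log (p+q) := by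
      rw [show log 2 + 2 * log p = log (2*p^2) by
        rw [Real.log_mul (by norm_num) (by positivity), Real.log_pow]; norm_num]
      exact Real.log_le_log (by positivity) c3.le
    have m1 := mul_le_mul_of_nonneg_left l4 hs0.le
    have m2 := mul_le_mul_of_nonneg_left l5 hs0.le
    have m3 := mul_le_mul_of_nonneg_left l6 hp0.le
    rw [hl2p] at hl2p0 ⊢
    linarith

lemma gamma_half (x : ℝ) (hx : 0 < x) : Gamma (x + 1/2) ≤ exp (1/2 * log x) * Gamma x := by
  have h := Real.Gamma_mul_add_mul_le_rpow_Gamma_mul_rpow_Gamma hx (show 0 < x+1 by linarith)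
    (show (0:ℝ) < 1/2 by norm_num) (show (0:ℝ) < 1/2 by norm_num) (by norm_num)
  rw [show 1/2*x + 1/2*(x+1) = x + 1/2 by ring, Real.Gamma_add_one hx.ne',
    Real.mul_rpow hx.le (Gamma_pos_of_pos hx).le, Real.rpow_def_of_pos hx] at h
  calc _ ≤ _ := h
    _ = exp (1/2 * log x) * (Gamma x ^ (1/2:ℝ) * Gamma x ^ (1/2:ℝ)) := by rw [mul_comm (log x)]; ring
    _ = _ := by rw [← Real.rpow_add (Gamma_pos_of_pos hx)]; norm_num

lemma gamma_k (p : ℝ) (hp : 3/2 ≤ p) (k : ℕ) :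
    Gamma (p + k/2) ≤ Gamma p * exp ((k/2 : ℝ) * log (p + k/2)) := by
  have hG := Gamma_pos_of_pos (show 0 < p by linarith)
  induction k with
  | zero => simp
  | succ k ih =>
    have h := gamma_half (p + k/2) (by positivity)
    rw [show p + ((k+1 : ℕ):ℝ)/2 = p + k/2 + 1/2 by push_cast; ring]
    refine h.trans ((mul_le_mul_of_nonneg_left ih (exp_pos _).le).trans ?_)
    rw [mul_left_comm, ← exp_add]
    gcongr
    have : log (p + k/2) ≤ log (p + k/2 + 1/2) := Real.log_le_log (by positivity) (by linarith)
    push_cast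
    have h9 := mul_le_mul_of_nonneg_left this (show (0:ℝ) ≤ (k+1)/2 by positivity)
    linarith

lemma gamma_lower (p : ℝ) (hp : 3/2 ≤ p) : exp (p * log p - p) ≤ Gamma p * p := by
  have hp0 : 0 < p := by linarith
  rw [mul_comm (Gamma p), ← Real.Gamma_add_one hp0.ne', Real.Gamma_eq_integral (by linarith)]
  have hc := Real.GammaIntegral_convergent (show 0 < p + 1 by linarith)
  have h0 : exp (p * log p - p) = ∫ x in Set.Ioi p, exp (p * log p) * exp (-x) := by
    rw [integral_const_mul, integral_exp_neg_Ioi, ← exp_add]; ring_nf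
  rw [h0]
  have hsub : Set.Ioi p ⊆ Set.Ioi (0:ℝ) := Set.Ioi_subset_Ioi hp0.le
  refine le_trans (setIntegral_mono_on ?_ (hc.mono_set hsub) measurableSet_Ioi ?_) 
    (setIntegral_mono_set hc ?_ (HasSubset.Subset.eventuallyLE hsub))
  · exact (integrableOn_exp_neg_Ioi p).const_mul _
  · intro x hx
    have hx : p < x := hx
    rw [mul_comm, show p + 1 - 1 = p by ring, Real.rpow_def_of_pos (by linarith), mul_comm (log x)]
    gcongr
  · filter_upwards [ae_restrict_mem measurableSet_Ioi] with x hx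
    have : (0:ℝ) < x := hx
    simp only [Pi.zero_apply]; positivity

lemma tail_int (s a : ℝ) (hs : 3/2 ≤ s) (ha : s ≤ a) :
   (∫ t in Set.Ioi a, t^(s-1) * exp (-t)) ≤ exp (s * log a - a) := by
  have ha0 : 0 < a := by linarith
  have hc := Real.GammaIntegral_convergent (show 0 < s by linarith)
  have hsub : Set.Ioi a ⊆ Set.Ioi (0:ℝ) := Set.Ioi_subset_Ioi ha0.le
  have hneg : -(1/a) < 0 := by simpa using ha0
  have h0 : exp (s * log a - a) = ∫ x in Set.Ioi a, exp ((s-1) * log a - a + 1) * exp (-(1/a) * x) := by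
    rw [integral_const_mul, integral_exp_mul_Ioi hneg]
    rw [show s * log a - a = log a + ((s-1) * log a - a) by ring, exp_add, exp_log ha0,
      exp_add (_ - a), show -(1/a)*a = -1 by field_simp, exp_neg]
    have := exp_pos 1
    field_simp
  rw [h0]
  refine setIntegral_mono_on ?_ ?_ measurableSet_Ioi ?_
  · have := hc.mono_set hsub
    simpa only [mul_comm] using this
  · exact (integrableOn_exp_mul_Ioi hneg a).const_mul _
  · intro t ht
    have ht : a < t := ht
    have ht0 : 0 < t := by linarith
    rw [Real.rpow_def_of_pos ht0, ← exp_add, ← exp_add]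
    apply Real.exp_le_exp.mpr
    have h := Real.log_le_sub_one_of_pos (show 0 < t/a by positivity)
    rw [Real.log_div ht0.ne' ha0.ne'] at h
    have h5 := mul_le_mul_of_nonneg_left h (show 0 ≤ s - 1 by linarith)
    have h6 : (s-1)*(t/a-1) ≤ (a-1)*(t/a-1) := by
      gcongr
      rw [sub_nonneg, le_div_iff₀ ha0]; linarith
    have h7 : (a-1)*(t/a-1) = t - a - t/a + 1 := by field_simp; ring
    have h8 : 1/a*t = t/a := by ring
    linarith

lemma radial (d : ℕ) (hd : 3 ≤ d) (c a σ : ℝ) (k : ℕ) (hσ : 0 < σ) (hc : 0 < c) (hca : σ * c^2 = a) :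
    (∫ x in {y : EuclideanSpace ℝ (Fin d) | c ≤ ‖y‖},
        (σ / π) ^ ((d : ℝ) / 2) * ‖x‖ ^ k * Real.exp (-σ * ‖x‖ ^ 2)) =
    (∫ t in Set.Ioi a, t^((d : ℝ)/2 + k/2 - 1) * exp (-t)) / (Gamma ((d:ℝ)/2) * σ ^ ((k:ℝ)/2)) := by
  have hd0 : (0:ℝ) < d := by positivity
  haveI : NeZero d := ⟨by omega⟩
  haveI : Nonempty (Fin d) := ⟨0⟩
  have ha0 : 0 < a := by rw [← hca]; positivity
  set F : ℝ → ℝ := (Set.Ici c).indicator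
    (fun r => (σ / π) ^ ((d : ℝ) / 2) * r ^ k * Real.exp (-σ * r ^ 2)) with hF
  set g : ℝ → ℝ := (Set.Ici a).indicator (fun t => t^((d : ℝ)/2 + k/2 - 1) * exp (-t)) with hg
  have hm : MeasurableSet {y : EuclideanSpace ℝ (Fin d) | c ≤ ‖y‖} :=
    measurableSet_le measurable_const measurable_norm
  have e1 : (∫ x in {y : EuclideanSpace ℝ (Fin d) | c ≤ ‖y‖},
        (σ / π) ^ ((d : ℝ) / 2) * ‖x‖ ^ k * Real.exp (-σ * ‖x‖ ^ 2)) =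
      ∫ x : EuclideanSpace ℝ (Fin d), F ‖x‖ := by
    rw [← integral_indicator hm]
    rfl
  have e2 : (∫ t in Set.Ioi a, t^((d : ℝ)/2 + k/2 - 1) * exp (-t)) = ∫ t in Set.Ioi 0, g t := by
    rw [hg, setIntegral_indicator measurableSet_Ici,
      Set.inter_eq_self_of_subset_right (show Set.Ici a ⊆ Set.Ioi 0 from fun x hx => lt_of_lt_of_le ha0 hx), integral_Ici_eq_integral_Ioi]
  have e3 : (∫ t in Set.Ioi 0, g t) = σ * ∫ x in Set.Ioi (0:ℝ), (2 * x) * g (σ * x^2) := by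
    have h1 := integral_comp_mul_left_Ioi g 0 hσ
    have h2 := integral_comp_rpow_Ioi (fun x => g (σ * x)) (p := 2) (by norm_num)
    rw [h1, mul_zero, smul_eq_mul] at h2
    have h3 : (∫ x in Set.Ioi (0:ℝ), (2 * x) * g (σ * x^2)) = σ⁻¹ * ∫ t in Set.Ioi 0, g t := by
      rw [← h2]
      congr 1
      ext x
      norm_num
    rw [h3]; field_simp
  have e4 : ∀ x ∈ Set.Ioi (0:ℝ), x^(d-1) • F x =
      ((σ / π) ^ ((d : ℝ) / 2) * σ / (2 * σ ^ ((d:ℝ)/2 + k/2))) * ((2 * x) * g (σ * x^2)) := by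
    intro x hx
    have hx : 0 < x := hx
    by_cases hcx : c ≤ x
    · have hax : a ≤ σ * x^2 := by rw [← hca]; gcongr
      rw [hF, hg, Set.indicator_of_mem (by exact hcx), Set.indicator_of_mem (by exact hax), smul_eq_mul]
      have p1 : (σ * x^2)^((d:ℝ)/2 + k/2 - 1) = σ ^ ((d:ℝ)/2 + k/2) / σ * (x^(d-1) * x^k / x) := by
        rw [Real.mul_rpow hσ.le (by positivity), Real.rpow_sub_one hσ.ne', ← Real.rpow_natCast x 2,
          ← Real.rpow_mul hx.le, ← Real.rpow_natCast x (d-1), ← Real.rpow_natCast x k,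
          ← Real.rpow_add hx, ← Real.rpow_sub_one hx.ne']
        congr 2
        rw [Nat.cast_sub (by omega)]; push_cast; ring
      rw [p1, neg_mul]
      have : 0 < σ ^ ((d:ℝ)/2 + k/2) := by positivity
      field_simp
    · have hax : ¬ a ≤ σ * x^2 := by
        rw [← hca]; push Not at hcx ⊢; gcongr
      rw [hF, hg, Set.indicator_of_notMem (by exact hcx), Set.indicator_of_notMem (by exact hax)]
      simp
  have hv : (volume : Measure (EuclideanSpace ℝ (Fin d))).real (Metric.ball 0 1) =
      π ^ ((d:ℝ)/2) / ((d:ℝ)/2 * Gamma ((d:ℝ)/2)) := by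
    rw [Measure.real, EuclideanSpace.volume_ball]
    have hG := Gamma_pos_of_pos (show 0 < (d:ℝ)/2 by positivity)
    simp only [Fintype.card_fin]
    rw [Real.Gamma_add_one (by positivity), ENNReal.ofReal_one, one_pow, one_mul,
      ENNReal.toReal_ofReal (by positivity), Real.sqrt_eq_rpow, ← Real.rpow_natCast, ← Real.rpow_mul pi_pos.le]
    congr 2; ring
  rw [e1, integral_fun_norm_addHaar, finrank_euclideanSpace_fin, hv, setIntegral_congr_fun measurableSet_Ioi e4,
    integral_const_mul, e2, e3]
  have hG := Gamma_pos_of_pos (show 0 < (d:ℝ)/2 by positivity)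
  rw [nsmul_eq_mul, smul_eq_mul, Real.rpow_add hσ, Real.div_rpow hσ.le pi_pos.le]
  have : 0 < σ ^ ((d:ℝ)/2) := by positivity
  have : 0 < σ ^ ((k:ℝ)/2) := by positivity
  have : 0 < π ^ ((d:ℝ)/2) := by positivity
  field_simp

theorem weighted_gaussian_tail_upper (d : ℕ) (hd : 3 ≤ d) (β σ : ℝ)
    (hβ : 0 < β) (hσ : 0 < σ) (k : ℕ) :
    (∫ x in {y : EuclideanSpace ℝ (Fin d) |
        Real.sqrt (d * (1 + β)) / Real.sqrt (2 * σ) ≤ ‖y‖},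
        (σ / π) ^ ((d : ℝ) / 2) * ‖x‖ ^ k * Real.exp (-σ * ‖x‖ ^ 2))
      ≤ (d : ℝ) ^ (1 + k) * ((1 + β) / (2 * σ)) ^ ((k : ℝ) / 2) *
          ((1 + β) / Real.exp β) ^ ((d : ℝ) / 2)
        + (∫ t in Set.Ioi (0:ℝ), t ^ (((d : ℝ) + k) / 2 - 1) * Real.exp (-t)) /
            (∫ t in Set.Ioi (0:ℝ), t ^ ((d : ℝ) / 2 - 1) * Real.exp (-t)) *
            (((d : ℝ) + k) / σ ^ ((k : ℝ) / 2)) *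
            Real.exp (-((d : ℝ) ^ 2 * (1 + β)) / (2 * ((d : ℝ) + k))) := by
  have hd3 : (3:ℝ) ≤ d := by exact_mod_cast hd
  have hd0 : (0:ℝ) < d := by linarith
  have hp : 3/2 ≤ (d:ℝ)/2 := by linarith
  have hk : (0:ℝ) ≤ (k:ℝ)/2 := by positivity
  have hGint : ∀ s : ℝ, 0 < s → (∫ t in Set.Ioi (0:ℝ), t ^ (s - 1) * Real.exp (-t)) = Gamma s := by
    intro s hs
    rw [Real.Gamma_eq_integral hs]; simp only [mul_comm]
  rw [hGint _ (by positivity), hGint _ (by positivity)]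
  rw [radial d hd _ (d * (1+β)/2) σ k hσ (by positivity)
    (by rw [div_pow, Real.sq_sqrt (by positivity), Real.sq_sqrt (by positivity)]; field_simp)]
  have ha : (d:ℝ)/2 < d * (1+β)/2 := by nlinarith
  have hGp := Gamma_pos_of_pos (show 0 < (d:ℝ)/2 by positivity)
  have hGs := Gamma_pos_of_pos (show 0 < (d:ℝ)/2 + k/2 by positivity)
  have hle : (∫ t in Set.Ioi ((d:ℝ) * (1+β)/2), t^((d : ℝ)/2 + k/2 - 1) * exp (-t)) ≤
      Gamma ((d:ℝ)/2 + k/2) := by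
    rw [← hGint _ (by positivity)]
    have hc := Real.GammaIntegral_convergent (show 0 < (d:ℝ)/2 + k/2 by positivity)
    refine setIntegral_mono_set ?_ ?_ (HasSubset.Subset.eventuallyLE
      (Set.Ioi_subset_Ioi (by positivity)))
    · simpa only [mul_comm] using hc
    · filter_upwards [ae_restrict_mem measurableSet_Ioi] with x hx
      have : (0:ℝ) < x := hx
      simp only [Pi.zero_apply]; positivity
  have key := core ((d:ℝ)/2) ((k:ℝ)/2) (d * (1+β)/2) _ _ _ hp hk ha hGp hGs (gamma_k _ hp k) hle
    (fun h => tail_int _ _ (by linarith) h) (gamma_lower _ hp)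
  have hσk : 0 < σ ^ ((k:ℝ)/2) := by positivity
  rw [div_le_iff₀ (by positivity)]
  refine key.trans (le_of_eq ?_)
  have t1 : (d : ℝ) ^ (1 + k) * ((1 + β) / (2 * σ)) ^ ((k : ℝ) / 2) *
          ((1 + β) / Real.exp β) ^ ((d : ℝ) / 2) * σ ^ ((k:ℝ)/2) =
      exp ((d:ℝ)/2 - d/2 * log (d/2) + (1+k/2) * log (2*(d/2)) + (d/2+k/2) * log (d * (1+β)/2)
        - d * (1+β)/2) := by
    have hb : 0 < 1 + β := by linarith
    rw [← Real.rpow_natCast, Real.rpow_def_of_pos hd0, Real.rpow_def_of_pos (by positivity),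
      Real.rpow_def_of_pos (by positivity), Real.rpow_def_of_pos hσ, ← exp_add, ← exp_add, ← exp_add,
      Real.log_div hb.ne' (by positivity), Real.log_div hb.ne' (by positivity), Real.log_exp,
      Real.log_mul (by norm_num) hσ.ne', Real.log_div (by positivity) (by norm_num),
      Real.log_div (by positivity) (by norm_num), Real.log_mul hd0.ne' hb.ne',
      show 2 * ((d:ℝ)/2) = d by ring]
    congr 1
    push_cast
    ring
  rw [← t1]
  have t2 : -((d:ℝ) * (1+β)/2 * (d/2) / (d/2+k/2)) = -((d : ℝ) ^ 2 * (1 + β)) / (2 * ((d : ℝ) + k)) := by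
    field_simp
  rw [t2, show ((d:ℝ)+k)/2 = d/2+k/2 by ring]
  field_simp
end

section
/- Let d be a positive integer and define φ : ℝ^d → ℝ by φ(x) = (2π)^{-d/2} exp(−‖x‖₂²/2) and g : ℝ^d → ℝ by g(x) = Σ_{j=1}^d (max{|x_j| − √(2d), 0})². Then (1/50) d^{-3/2} e^{-d} ≤ ∫_{ℝ^d} |g(x)|² φ(x) dx ≤ 3 d² e^{-d}. -/
open Real MeasureTheory

noncomputable def nsfP (y : ℝ) : ℝ := (√(2 * π))⁻¹ * Real.exp (-(1/2) * y ^ 2)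

noncomputable def nsfH (a y : ℝ) : ℝ := max (|y| - a) 0 ^ 4

lemma nsfP_nonneg (y : ℝ) : 0 ≤ nsfP y := by unfold nsfP; positivity

lemma nsfH_nonneg (a y : ℝ) : 0 ≤ nsfH a y := by unfold nsfH; positivity

lemma nsfP_cont : Continuous nsfP := by unfold nsfP; fun_prop

lemma nsfH_cont (a : ℝ) : Continuous (nsfH a) := by unfold nsfH; fun_prop

lemma nsfP_integrable : Integrable nsfP :=
  (integrable_exp_neg_mul_sq (by norm_num : (0:ℝ) < 1/2)).const_mul _

lemma nsfP_integral : ∫ y, nsfP y = 1 := by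
  unfold nsfP
  rw [integral_const_mul, integral_gaussian]
  rw [show π / (1/2) = 2 * π by ring]
  exact inv_mul_cancel₀ (by positivity)

lemma nsf4_integrable : Integrable (fun y => y ^ 4 * nsfP y) := by
  have h := (integrable_rpow_mul_exp_neg_mul_sq (by norm_num : (0:ℝ) < 1/2)
    (by norm_num : (-1:ℝ) < (4:ℕ))).const_mul (√(2 * π))⁻¹
  simp only [rpow_natCast] at h
  refine h.congr (Filter.Eventually.of_forall fun y => ?_)
  simp only [nsfP]; ring

lemma nsf4_integral : 2 * ∫ y in Set.Ioi (0:ℝ), y ^ 4 * nsfP y = 3 := by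
  have h := integral_rpow_mul_exp_neg_mul_rpow (by norm_num : (0:ℝ) < (2:ℕ))
    (by norm_num : (-1:ℝ) < (4:ℕ)) (by norm_num : (0:ℝ) < 1/2)
  simp only [rpow_natCast] at h
  have e : ∀ y : ℝ, y ^ 4 * nsfP y = (√(2 * π))⁻¹ * (y ^ 4 * Real.exp (-(1/2) * y ^ 2)) := by
    intro y; simp only [nsfP]; ring
  simp_rw [e]
  rw [integral_const_mul, h]
  have g := Real.Gamma_nat_add_half 2
  have h5 : (((4:ℕ):ℝ) + 1) / (2:ℕ) = (2:ℕ) + 1/2 := by norm_num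
  have h2 : (1 / 2 : ℝ) ^ (-(((4:ℕ):ℝ) + 1) / (2:ℕ)) = 4 * √2 := by
    rw [one_div, inv_rpow (by norm_num), ← rpow_neg (by norm_num), sqrt_eq_rpow,
      show -(-(((4:ℕ):ℝ) + 1) / (2:ℕ)) = 2 + 1/2 by norm_num, rpow_add (by norm_num)]
    norm_num
  rw [h5, g, h2, sqrt_mul (by norm_num)]
  have : √2 ≠ 0 := by positivity
  have : √π ≠ 0 := by positivity
  norm_num [Nat.doubleFactorial]
  field_simp

lemma nsfHP_integrable {a : ℝ} (ha : 0 ≤ a) : Integrable (fun y => nsfH a y * nsfP y) := by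
  refine nsf4_integrable.mono' ((nsfH_cont a).mul nsfP_cont).aestronglyMeasurable
    (Filter.Eventually.of_forall fun y => ?_)
  rw [norm_of_nonneg (mul_nonneg (nsfH_nonneg a y) (nsfP_nonneg y))]
  refine mul_le_mul_of_nonneg_right ?_ (nsfP_nonneg y)
  have : y ^ 4 = |y| ^ 4 := by rw [← abs_pow, abs_of_nonneg (by positivity)]
  rw [this, nsfH]
  gcongr
  exact max_le (by linarith) (abs_nonneg y)

lemma nsfM_eq (a : ℝ) : ∫ y, nsfH a y * nsfP y =
    2 * ∫ y in Set.Ioi (0:ℝ), nsfH a y * nsfP y := by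
  rw [← integral_comp_abs (f := fun y => nsfH a y * nsfP y)]
  simp [nsfH, nsfP]

lemma nsfM_upper {a : ℝ} (ha : 0 ≤ a) :
    ∫ y, nsfH a y * nsfP y ≤ 3 * Real.exp (-a ^ 2 / 2) := by
  rw [nsfM_eq, ← nsf4_integral]
  have h1 : ∫ y in Set.Ioi (0:ℝ), nsfH a y * nsfP y ≤
      ∫ y, (Set.Ioi (0:ℝ)).indicator (fun t => t ^ 4 * nsfP t) (y - a) * Real.exp (-a ^ 2 / 2) := by
    rw [← integral_indicator measurableSet_Ioi]
    refine integral_mono ((nsfHP_integrable ha).indicator measurableSet_Ioi)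
      (((nsf4_integrable.indicator measurableSet_Ioi).comp_sub_right a).mul_const _) ?_
    intro y
    by_cases hy : a < y
    · have hy0 : 0 < y := lt_of_le_of_lt ha hy
      have hya : 0 < y - a := by linarith
      simp only [Set.indicator, Set.mem_Ioi, hy0, hya, if_true, nsfH, nsfP, abs_of_pos,
        max_eq_left hya.le]
      have : Real.exp (-(1/2) * y ^ 2) ≤
          Real.exp (-(1/2) * (y - a) ^ 2) * Real.exp (-a ^ 2 / 2) := by
        rw [← Real.exp_add]
        apply Real.exp_le_exp.2
        nlinarith
      calc _ ≤ (y - a) ^ 4 * ((√(2 * π))⁻¹ *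
          (Real.exp (-(1/2) * (y - a) ^ 2) * Real.exp (-a ^ 2 / 2))) := by gcongr
        _ = _ := by ring
    · have hya : ¬ 0 < y - a := by linarith
      by_cases hy0 : 0 < y
      · simp [Set.indicator, hy0, hy, nsfH, abs_of_pos, max_eq_right (not_lt.1 hya)]
      · simp [Set.indicator, hy0, hy]
  rw [integral_mul_const, integral_sub_right_eq_self (fun y => (Set.Ioi (0:ℝ)).indicator
    (fun t => t ^ 4 * nsfP t) y), integral_indicator measurableSet_Ioi] at h1
  linarith

lemma nsfM_lower {a : ℝ} (ha : 0 < a) (ha2 : 2 ≤ a ^ 2) :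
    2 * ((√(2 * π))⁻¹ * Real.exp (-a ^ 2 / 2 - 3) * ((2 / a) ^ 5 / 5)) ≤
    ∫ y, nsfH a y * nsfP y := by
  rw [nsfM_eq]
  refine mul_le_mul_of_nonneg_left ?_ (by norm_num)
  have hle : a ≤ a + 2 / a := by have : 0 < 2 / a := by positivity
                                 linarith
  have h1 : ∫ y in Set.Ioc a (a + 2 / a), nsfH a y * nsfP y ≤
      ∫ y in Set.Ioi (0:ℝ), nsfH a y * nsfP y := by
    refine setIntegral_mono_set (nsfHP_integrable ha.le).integrableOn
      (Filter.Eventually.of_forall fun y => mul_nonneg (nsfH_nonneg a y) (nsfP_nonneg y)) ?_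
    exact (show Set.Ioc a (a + 2 / a) ⊆ Set.Ioi 0 from
      fun y hy => lt_trans ha hy.1).eventuallyLE
  refine le_trans ?_ h1
  have h2 : (√(2 * π))⁻¹ * Real.exp (-a ^ 2 / 2 - 3) * ((2 / a) ^ 5 / 5) =
      ∫ y in Set.Ioc a (a + 2 / a), (√(2 * π))⁻¹ * Real.exp (-a ^ 2 / 2 - 3) * (y - a) ^ 4 := by
    rw [integral_const_mul, ← intervalIntegral.integral_of_le hle,
      intervalIntegral.integral_comp_sub_right (fun y => y ^ 4) a, integral_pow]
    norm_num
  rw [h2]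
  refine setIntegral_mono_on (Continuous.integrableOn_Ioc (by fun_prop))
    (nsfHP_integrable ha.le).integrableOn measurableSet_Ioc ?_
  intro y hy
  have hy0 : 0 < y := lt_trans ha hy.1
  have hya : 0 < y - a := by linarith [hy.1]
  simp only [nsfH, nsfP, abs_of_pos hy0, max_eq_left hya.le]
  have hs : a * (y - a) ≤ 2 := by
    have : y - a ≤ 2 / a := by linarith [hy.2]
    rw [le_div_iff₀ ha] at this; linarith
  have hs2 : (y - a) ^ 2 ≤ 2 := by
    have h3 : (a * (y - a)) ^ 2 ≤ 2 ^ 2 := by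
      have : 0 ≤ a * (y - a) := by positivity
      gcongr
    nlinarith [sq_nonneg (y - a)]
  have : Real.exp (-a ^ 2 / 2 - 3) ≤ Real.exp (-(1/2) * y ^ 2) := by
    apply Real.exp_le_exp.2
    nlinarith
  calc _ ≤ (√(2 * π))⁻¹ * Real.exp (-(1/2) * y ^ 2) * (y - a) ^ 4 := by gcongr
    _ = _ := by ring

lemma nsf_phi (d : ℕ) (x : EuclideanSpace ℝ (Fin d)) :
    (2 * π) ^ (-(d : ℝ) / 2) * Real.exp (-‖x‖ ^ 2 / 2) = ∏ i, nsfP (x i) := by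
  simp only [nsfP]
  rw [Finset.prod_mul_distrib, ← Real.exp_sum, Finset.prod_const, Finset.card_univ,
    Fintype.card_fin, EuclideanSpace.norm_sq_eq, ← Finset.mul_sum]
  congr 1
  · rw [sqrt_eq_rpow, ← rpow_neg (by positivity), ← rpow_natCast, ← rpow_mul (by positivity)]
    congr 1; ring
  · congr 1
    simp only [norm_eq_abs, sq_abs]; ring

lemma nsf_prod (d : ℕ) (a : ℝ) (j : Fin d) (x : Fin d → ℝ) :
    nsfH a (x j) * ∏ i, nsfP (x i) =
    ∏ i, (if i = j then fun y => nsfH a y * nsfP y else nsfP) (x i) := by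
  have : ∀ i, (if i = j then fun y => nsfH a y * nsfP y else nsfP) (x i) =
      (if i = j then nsfH a (x j) else 1) * nsfP (x i) := by
    intro i
    split_ifs with h
    · subst h; rfl
    · simp
  simp_rw [this]
  rw [Finset.prod_mul_distrib]
  simp

lemma nsf_coord_integrable (d : ℕ) {a : ℝ} (ha : 0 ≤ a) (j : Fin d) :
    Integrable (fun x : EuclideanSpace ℝ (Fin d) => nsfH a (x j) * ∏ i, nsfP (x i)) := by
  rw [← (PiLp.volume_preserving_toLp (Fin d)).integrable_comp_emb
    (MeasurableEquiv.toLp 2 _).measurableEmbedding]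
  simp only [Function.comp_def]
  simp_rw [nsf_prod]
  refine Integrable.fintype_prod (f := fun i => if i = j then fun y => nsfH a y * nsfP y else nsfP)
    fun i => ?_
  dsimp only
  split_ifs
  · exact nsfHP_integrable ha
  · exact nsfP_integrable

lemma nsf_coord_integral (d : ℕ) (a : ℝ) (j : Fin d) :
    ∫ x : EuclideanSpace ℝ (Fin d), nsfH a (x j) * ∏ i, nsfP (x i) =
      ∫ y, nsfH a y * nsfP y := by
  rw [← (PiLp.volume_preserving_toLp (Fin d)).integral_comp
    (MeasurableEquiv.toLp 2 _).measurableEmbedding]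
  simp_rw [nsf_prod]
  rw [integral_fintype_prod_volume_eq_prod
    (f := fun i => if i = j then fun y => nsfH a y * nsfP y else nsfP)]
  rw [Finset.prod_eq_single j]
  · simp
  · intro i _ hi
    simp [hi, nsfP_integral]
  · simp

theorem norm_of_specific_function_bounds (d : ℕ) (hd : 1 ≤ d)
    (φ g : EuclideanSpace ℝ (Fin d) → ℝ)
    (hφ : ∀ x, φ x = (2 * π) ^ (-(d : ℝ) / 2) * Real.exp (-‖x‖ ^ 2 / 2))
    (hg : ∀ x, g x = ∑ j, max (|x j| - Real.sqrt (2 * d)) 0 ^ 2) :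
    (1 / 50) * (d : ℝ) ^ (-(3 : ℝ) / 2) * Real.exp (-d) ≤ (∫ x, |g x| ^ 2 * φ x) ∧
    (∫ x, |g x| ^ 2 * φ x) ≤ 3 * d ^ 2 * Real.exp (-d) := by
  have hd1 : (1:ℝ) ≤ d := by exact_mod_cast hd
  have hd0 : (0:ℝ) < d := by linarith
  set a : ℝ := √(2 * d) with hadef
  have ha : 0 < a := by positivity
  have ha2 : a ^ 2 = 2 * d := Real.sq_sqrt (by positivity)
  set M := ∫ y, nsfH a y * nsfP y with hM
  set S : EuclideanSpace ℝ (Fin d) → ℝ :=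
    fun x => ∑ j, nsfH a (x j) * ∏ i, nsfP (x i) with hS
  have hSi : Integrable S := integrable_finsetSum _ fun j _ => nsf_coord_integrable d ha.le j
  have hSint : ∫ x, S x = d * M := by
    simp only [hS]
    rw [integral_finsetSum _ fun j _ => nsf_coord_integrable d ha.le j]
    simp_rw [nsf_coord_integral]
    simp [hM]
  have hp : ∀ x : EuclideanSpace ℝ (Fin d), 0 ≤ ∏ i, nsfP (x i) :=
    fun x => Finset.prod_nonneg fun i _ => nsfP_nonneg _
  have hsq : ∀ y : ℝ, nsfH a y = (max (|y| - a) 0 ^ 2) ^ 2 := by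
    intro y; simp only [nsfH]; ring
  have hlow : ∀ x, S x ≤ |g x| ^ 2 * φ x := by
    intro x
    rw [hφ, nsf_phi, sq_abs, hg]
    simp only [hS]
    rw [← Finset.sum_mul]
    refine mul_le_mul_of_nonneg_right ?_ (hp x)
    simp_rw [hsq]
    exact Finset.sum_sq_le_sq_sum_of_nonneg fun i _ => by positivity
  have hup : ∀ x, |g x| ^ 2 * φ x ≤ d * S x := by
    intro x
    rw [hφ, nsf_phi, sq_abs, hg]
    simp only [hS]
    rw [← Finset.sum_mul, ← mul_assoc]
    refine mul_le_mul_of_nonneg_right ?_ (hp x)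
    simp_rw [hsq]
    simpa using sq_sum_le_card_mul_sum_sq (s := (Finset.univ : Finset (Fin d)))
      (f := fun j => max (|x j| - a) 0 ^ 2)
  have hS0 : ∀ x, 0 ≤ S x := fun x =>
    Finset.sum_nonneg fun j _ => mul_nonneg (nsfH_nonneg _ _) (hp x)
  have hcont : Continuous fun x => |g x| ^ 2 * φ x := by
    have : g = fun x => ∑ j, max (|x j| - a) 0 ^ 2 := funext hg
    have : φ = _ := funext hφ
    subst g; subst φ
    fun_prop
  have hI : Integrable fun x => |g x| ^ 2 * φ x := by
    refine (hSi.const_mul (d:ℝ)).mono' hcont.aestronglyMeasurable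
      (Filter.Eventually.of_forall fun x => ?_)
    rw [norm_of_nonneg ((hS0 x).trans (hlow x))]
    exact hup x
  have e1 : Real.exp (-a ^ 2 / 2) = Real.exp (-d) := by
    congr 1; rw [neg_div, ha2]; ring
  constructor
  · refine le_trans ?_ (integral_mono hSi hI hlow)
    rw [hSint]
    have hl := nsfM_lower ha (by rw [ha2]; linarith)
    refine le_trans ?_ (mul_le_mul_of_nonneg_left hl hd0.le)
    rw [sub_eq_add_neg, Real.exp_add, e1]
    have h3 : (1:ℝ)/21 ≤ Real.exp (-3) := by
      rw [Real.exp_neg, one_div]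
      apply inv_anti₀ (Real.exp_pos _)
      have : Real.exp 3 = Real.exp 1 ^ 3 := by rw [← Real.exp_nat_mul]; norm_num
      rw [this]
      calc _ ≤ (2.72:ℝ) ^ 3 := by
            gcongr; linarith [Real.exp_one_lt_d9]
        _ ≤ 21 := by norm_num
    have hpi : √(2 * π) ≤ 3 := by
      apply Real.sqrt_le_iff.2 ⟨by norm_num, by linarith [Real.pi_lt_d2]⟩
    have hpi' : (1:ℝ)/3 ≤ (√(2 * π))⁻¹ := by
      rw [one_div]; exact inv_anti₀ (by positivity) hpi
    have hr : (d : ℝ) ^ (-(3 : ℝ) / 2) = 1 / (d * √d) := by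
      rw [neg_div, rpow_neg hd0.le, show (3:ℝ)/2 = 1 + 1/2 by norm_num, rpow_add hd0,
        ← sqrt_eq_rpow, rpow_one, one_div]
    have hsd : 0 < √(d:ℝ) := by positivity
    have h5 : a ^ 5 = 4 * d ^ 2 * (√2 * √d) := by
      rw [show a ^ 5 = (a ^ 2) ^ 2 * a by ring, ha2, hadef, sqrt_mul (by norm_num)]; ring
    have h2 : √2 ≤ 1.5 := by
      apply Real.sqrt_le_iff.2 ⟨by norm_num, by norm_num⟩
    have h5' : 1 / (d * √d) * (16 / 15) ≤ d * ((2 / a) ^ 5 / 5) := by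
      rw [div_pow, h5]
      have : (d:ℝ) * (2 ^ 5 / (4 * d ^ 2 * (√2 * √d)) / 5) = 1 / (d * √d) * (8 / 5 / √2) := by
        field_simp; norm_num
      rw [this]
      refine mul_le_mul_of_nonneg_left ?_ (by positivity)
      rw [le_div_iff₀ (by positivity)]
      linarith
    rw [hr]
    calc 1 / 50 * (1 / (d * √d)) * Real.exp (-d)
        ≤ 2 * (1/3 * (1/21)) * (1 / (d * √d) * (16 / 15)) * Real.exp (-d) := by
          refine mul_le_mul_of_nonneg_right ?_ (Real.exp_pos _).le
          have : 0 ≤ 1 / (d * √d) := by positivity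
          linarith
      _ ≤ 2 * ((√(2 * π))⁻¹ * Real.exp (-3)) * (d * ((2 / a) ^ 5 / 5)) * Real.exp (-d) := by
          gcongr
      _ = _ := by ring
  · have h1 := integral_mono hI (hSi.const_mul (d:ℝ)) hup
    rw [integral_const_mul, hSint] at h1
    have hu := nsfM_upper ha.le
    rw [e1] at hu
    calc _ ≤ _ := h1
      _ ≤ d * (d * (3 * Real.exp (-d))) := by gcongr
      _ = _ := by ring
end
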